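/- Let m ≥ 1 be an integer and b, c > 0 real numbers, and let D be the m×m matrix over ℝ ∪ {-∞} with D_{1,1} = b, D_{i,i+1} = 0 for 1 ≤ i ≤ m-1, D_{m,1} = b + c, and all other entries equal to -∞. Then the max-plus spectral radius of D equals max( b, (b+c)/m ), i.e., max_{1≤p≤m} (1/p)·tr(D^⊗p) = max( b, (b+c)/m ). -/

import Mathlib

/- Max-plus algebra over `ℝ ∪ {-∞}`, modelled as `WithBot ℝ`. -/

/-- Max-plus product of matrices over `ℝ ∪ {-∞}`. -/
noncomputable def mpMul {n : ℕ} (A B : Fin n → Fin n → WithBot ℝ) :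
    Fin n → Fin n → WithBot ℝ :=
  fun i j => Finset.univ.sup fun k => A i k + B k j

/-- Max-plus identity matrix. -/
noncomputable def mpId {n : ℕ} : Fin n → Fin n → WithBot ℝ :=
  fun i j => if i = j then (0 : WithBot ℝ) else ⊥

/-- Max-plus matrix power, `A^⊗0 = I`. -/
noncomputable def mpPow {n : ℕ} (A : Fin n → Fin n → WithBot ℝ) :
    ℕ → Fin n → Fin n → WithBot ℝ
  | 0 => mpId
  | p + 1 => mpMul A (mpPow A p)

/-- Max-plus trace: maximum diagonal entry. -/
noncomputable def mpTr {n : ℕ} (A : Fin n → Fin n → WithBot ℝ) : WithBot ℝ :=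
  Finset.univ.sup fun i => A i i

/-- Scaling of an element of `ℝ ∪ {-∞}` by a real number (`(1/p)·(-∞) = -∞`). -/
noncomputable def mpScale (q : ℝ) (x : WithBot ℝ) : WithBot ℝ :=
  x.map fun r => q * r

/-- The `m×m` matrix `D` over `ℝ ∪ {-∞}` with `D_{1,1} = b`, `D_{i,i+1} = 0` for
`1 ≤ i ≤ m-1`, `D_{m,1} = b+c`, and all other entries `-∞` (in 0-based indexing:
entry `(0,0)` is `b`, the superdiagonal is `0`, entry `(m-1,0)` is `b+c`; coinciding
positions, which occur only when `m = 1`, are combined by maximum). -/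
noncomputable def Dmat (m : ℕ) (b c : ℝ) : Fin m → Fin m → WithBot ℝ :=
  fun i j =>
    (if (i : ℕ) = 0 ∧ (j : ℕ) = 0 then ((b : ℝ) : WithBot ℝ) else ⊥) ⊔
    (if (j : ℕ) = (i : ℕ) + 1 then (0 : WithBot ℝ) else ⊥) ⊔
    (if (i : ℕ) = m - 1 ∧ (j : ℕ) = 0 then ((b + c : ℝ) : WithBot ℝ) else ⊥)

theorem add_le_mpMul {n : ℕ} (A B : Fin n → Fin n → WithBot ℝ) (i k j : Fin n) :
    A i k + B k j ≤ mpMul A B i j :=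
  Finset.le_sup (f := fun k => A i k + B k j) (Finset.mem_univ k)

theorem le_mpPow_one {n : ℕ} (A : Fin n → Fin n → WithBot ℝ) (i j : Fin n) :
    A i j ≤ mpPow A 1 i j := by
  simpa [mpPow, mpId] using add_le_mpMul A mpId i j j

theorem mpScale_mono {q : ℝ} (hq : 0 ≤ q) : Monotone (mpScale q) :=
  Monotone.withBot_map fun _ _ h => mul_le_mul_of_nonneg_left h hq

/-- A matrix whose entries are bounded by `l + v i - v j` for a potential `v` has powers bounded by
`p * l + v i - v j`. -/
theorem mpPow_le_of_potential {n : ℕ} {A : Fin n → Fin n → WithBot ℝ} {l : ℝ} {v : Fin n → ℝ}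
    (h : ∀ i j, A i j ≤ ((l + v i - v j : ℝ) : WithBot ℝ)) (p : ℕ) (i j : Fin n) :
    mpPow A p i j ≤ ((p * l + v i - v j : ℝ) : WithBot ℝ) := by
  induction p generalizing i with
  | zero =>
    by_cases hij : i = j
    · subst hij
      simp [mpPow, mpId]
    · simp [mpPow, mpId, hij]
  | succ p ih =>
    rw [mpPow, mpMul]
    refine Finset.sup_le fun k _ => (add_le_add (h i k) (ih k)).trans ?_
    rw [← WithBot.coe_add, WithBot.coe_le_coe]
    push_cast
    linarith

theorem Dmat_le_potential {m : ℕ} {b c l : ℝ} (hbl : b ≤ l) (hcl : b + c ≤ m * l)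
    (i j : Fin m) :
    Dmat m b c i j ≤ ((l + (i : ℕ) * l - (j : ℕ) * l : ℝ) : WithBot ℝ) := by
  refine sup_le (sup_le ?_ ?_) ?_
  · split_ifs with h
    · rw [h.1, h.2]
      simpa using hbl
    · exact bot_le
  · split_ifs with h
    · rw [h, ← WithBot.coe_zero, WithBot.coe_le_coe]
      push_cast
      linarith
    · exact bot_le
  · split_ifs with h
    · have hi : ((i : ℕ) : ℝ) + 1 = m := by
        have := i.isLt
        exact_mod_cast (by omega : (i : ℕ) + 1 = m)
      rw [← hi] at hcl
      rw [h.2, WithBot.coe_le_coe]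
      push_cast
      linarith
    · exact bot_le

/-- Following the superdiagonal from row `i` to the last row and then returning to column `0`. -/
theorem le_mpPow_Dmat {m : ℕ} (b c : ℝ) (k : ℕ) (i j : Fin m) (hi : (i : ℕ) + k + 1 = m)
    (hj : (j : ℕ) = 0) :
    ((b + c : ℝ) : WithBot ℝ) ≤ mpPow (Dmat m b c) (k + 1) i j := by
  induction k generalizing i with
  | zero =>
    refine le_trans ?_ (le_mpPow_one _ i j)
    have h : (i : ℕ) = m - 1 ∧ (j : ℕ) = 0 := ⟨by omega, hj⟩
    unfold Dmat
    rw [if_pos h]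
    exact le_sup_right
  | succ k ih =>
    let i' : Fin m := ⟨i + 1, by omega⟩
    have h0 : (0 : WithBot ℝ) ≤ Dmat m b c i i' := by
      unfold Dmat
      rw [if_pos (show (i' : ℕ) = (i : ℕ) + 1 from rfl)]
      exact le_sup_of_le_left le_sup_right
    have h1 := ih i' (by simp only [i']; omega)
    refine le_trans ?_ (add_le_mpMul (Dmat m b c) (mpPow (Dmat m b c) (k + 1)) i i' j)
    simpa using add_le_add h0 h1

theorem le_mpTr {n : ℕ} (A : Fin n → Fin n → WithBot ℝ) (i : Fin n) : A i i ≤ mpTr A :=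
  Finset.le_sup (f := fun i => A i i) (Finset.mem_univ i)

/-- For an integer `m ≥ 1` and reals `b, c > 0`, the max-plus spectral radius
of the matrix `D` above equals `max(b, (b+c)/m)`, i.e.
`max_{1≤p≤m} (1/p)·tr(D^⊗p) = max(b, (b+c)/m)`. -/
theorem stmt_13 (m : ℕ) (hm : 1 ≤ m) (b c : ℝ) (hb : 0 < b) (hc : 0 < c) :
    ((Finset.Icc 1 m).sup fun p => mpScale ((p : ℝ)⁻¹) (mpTr (mpPow (Dmat m b c) p)))
      = ((max b ((b + c) / m) : ℝ) : WithBot ℝ) := by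
  have hm0 : (0 : ℝ) < m := by exact_mod_cast hm
  apply le_antisymm
  · set l := max b ((b + c) / m) with hl
    have hcl : b + c ≤ m * l := by
      have := (div_le_iff₀ hm0).mp (le_max_right b ((b + c) / m))
      linarith
    refine Finset.sup_le fun p hp => ?_
    have hp0 : (0 : ℝ) < p := by exact_mod_cast (Finset.mem_Icc.mp hp).1
    have htr : mpTr (mpPow (Dmat m b c) p) ≤ ((p * l : ℝ) : WithBot ℝ) :=
      Finset.sup_le fun i _ => by
        simpa using mpPow_le_of_potential (v := fun i : Fin m => (i : ℕ) * l)
          (Dmat_le_potential (le_max_left _ _) hcl) p i i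
    refine (mpScale_mono (inv_nonneg.mpr hp0.le) htr).trans ?_
    rw [mpScale, WithBot.map_coe, WithBot.coe_le_coe, inv_mul_cancel_left₀ hp0.ne']
  · have key (p : ℕ) (hp : p ∈ Finset.Icc 1 m) (x : ℝ)
        (hx : (x : WithBot ℝ) ≤ mpPow (Dmat m b c) p ⟨0, hm⟩ ⟨0, hm⟩) :
        (((p : ℝ)⁻¹ * x : ℝ) : WithBot ℝ) ≤ (Finset.Icc 1 m).sup fun p =>
          mpScale ((p : ℝ)⁻¹) (mpTr (mpPow (Dmat m b c) p)) :=
      (mpScale_mono (by positivity) (hx.trans (le_mpTr _ _))).trans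
        (Finset.le_sup (f := fun p : ℕ =>
          mpScale ((p : ℝ)⁻¹) (mpTr (mpPow (Dmat m b c) p))) hp)
    rw [WithBot.coe_max]
    refine max_le ?_ ?_
    · have h : (b : WithBot ℝ) ≤ Dmat m b c ⟨0, hm⟩ ⟨0, hm⟩ := by
        unfold Dmat
        rw [if_pos ⟨rfl, rfl⟩]
        exact le_sup_of_le_left le_sup_left
      simpa using key 1 (by simpa using hm) b (h.trans (le_mpPow_one _ _ _))
    · have h := le_mpPow_Dmat b c (m - 1) (⟨0, hm⟩ : Fin m) ⟨0, hm⟩ (by simp; omega) rfl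
      rw [Nat.sub_add_cancel hm] at h
      rw [div_eq_inv_mul]
      exact key m (by simpa using hm) (b + c) h
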